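/- For every integer k≥1, the weighted alternating sum of the coefficients satisfies ∑_{n=1}^{k} (−1)^n n c_{n,k} = −c_{0,k−1}. -/

import Mathlib

/-- The integer coefficients `c_{n,k}`. -/
def cCoef : ℕ → ℕ → ℤ
  | 0, 0 => 1
  | _ + 1, 0 => 0
  | 0, k + 1 => cCoef 0 k + cCoef 1 k
  | 1, k + 1 => cCoef 0 k + 2 * (cCoef 1 k + cCoef 2 k)
  | n + 2, k + 1 => ((n : ℤ) + 1) * cCoef (n + 1) k + 2 * ((n : ℤ) + 2) * cCoef (n + 2) k
      + ((n : ℤ) + 3) * cCoef (n + 3) k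

theorem cCoef_zero_of_lt (k : ℕ) : ∀ n, k < n → cCoef n k = 0 := by
  induction k with
  | zero =>
    intro n hn
    obtain ⟨m, rfl⟩ : ∃ m, n = m + 1 := ⟨n - 1, by omega⟩
    simp [cCoef]
  | succ k ih =>
    intro n hn
    obtain ⟨m, rfl⟩ : ∃ m, n = m + 2 := ⟨n - 2, by omega⟩
    rw [cCoef, ih (m+1) (by omega), ih (m+2) (by omega), ih (m+3) (by omega)]
    ring

theorem cCoef_partial (k N : ℕ) :
    ∑ n ∈ Finset.Icc 1 (N + 1), (-1 : ℤ) ^ n * (n : ℤ) * cCoef n (k + 1) =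
      -cCoef 0 k + (-1) ^ (N + 1) * ((N : ℤ) + 1) * (N + 2)
        * (cCoef (N + 1) k + cCoef (N + 2) k) := by
  induction N with
  | zero =>
    simp [cCoef]
    ring
  | succ N ih =>
    rw [Finset.sum_Icc_succ_top (by omega), ih, cCoef]
    push_cast
    ring

/-- For every `k ≥ 1`, `∑_{n=1}^{k} (−1)^n n c_{n,k} = −c_{0,k−1}`. -/
theorem weighted_alternating_sum_cCoef (k : ℕ) (hk : 1 ≤ k) :
    ∑ n ∈ Finset.Icc 1 k, (-1 : ℤ) ^ n * (n : ℤ) * cCoef n k = -cCoef 0 (k - 1) := by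
  obtain ⟨m, rfl⟩ : ∃ m, k = m + 1 := ⟨k - 1, by omega⟩
  rw [cCoef_partial, cCoef_zero_of_lt m (m+1) (by omega), cCoef_zero_of_lt m (m+2) (by omega)]
  simp
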